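/- Let q be an indeterminate and, for t₄ ∈ ℂ, let M₄(t₄) be the 6×6 matrix over ℂ[q] with rows (0, 2t₄q, 0, 0, 4q, 0), (4, 0, 2t₄q, 0, 0, 4q), (0, 4, 0, 0, 2t₄q, 0), (0, 4, 0, 0, 0, 0), (−2t₄, 0, 4, 4, 0, 2t₄q), (0, −2t₄, 0, 0, 4, 0). Then for every t₄ ∈ ℂ, the resultant of the characteristic polynomial of M₄(t₄) with its derivative equals 0; in particular, for every t₄ ∈ ℂ the characteristic polynomial of M₄(t₄), viewed over the field ℂ(q), is not squarefree, i.e. M₄(t₄) does not have simple spectrum. -/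

import Mathlib

/-- The resultant of two polynomials `p` and `q`, computed as the determinant of
the Sylvester matrix built with respect to the degree bounds `m` for `p` and
`n` for `q`. -/
noncomputable def sylvesterRes {R : Type*} [CommRing R] (m n : ℕ)
    (p q : Polynomial R) : R :=
  (Matrix.of (fun i j : Fin (m + n) =>
    if (i : ℕ) < n then
      (if (j : ℕ) ≤ m + (i : ℕ) then p.coeff (m + (i : ℕ) - (j : ℕ)) else 0)
    else
      (if (j : ℕ) ≤ ((i : ℕ) - n) + n then
        q.coeff (((i : ℕ) - n) + n - (j : ℕ)) else 0))).det

open Polynomial in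
/-- The energy-2 truncation of the Dubrovin operator of `Gr(2,4)` with bulk
parameter supported on the Schubert class `σ₍₂,₁₎`, as a matrix over `ℂ[q]`. -/
noncomputable def M4 (t : ℂ) : Matrix (Fin 6) (Fin 6) (Polynomial ℂ) :=
  !![0,            C (2 * t) * X, 0,             0, 4 * X,         0;
     4,            0,             C (2 * t) * X, 0, 0,             4 * X;
     0,            4,             0,             0, C (2 * t) * X, 0;
     0,            4,             0,             0, 0,             0;
     C (-2 * t),   0,             4,             4, 0,             C (2 * t) * X;
     0,            C (-2 * t),    0,             0, 4,             0]

theorem det_eq_sq_mul_of_M4_pattern {R : Type*} [CommRing R] (x a b c d : R) :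
    Matrix.det !![x, -a, 0, 0, -c, 0;
                  -d, x, -a, 0, 0, -c;
                  0, -d, x, 0, -a, 0;
                  0, -d, 0, x, 0, 0;
                  -b, 0, -d, -d, x, -a;
                  0, -b, 0, 0, -d, x] =
      x ^ 2 * (x ^ 4 - (4 * a * d + 2 * b * c) * x ^ 2 +
        (2 * a ^ 2 * d ^ 2 - 2 * a ^ 3 * b - 4 * c * d ^ 3 + b ^ 2 * c ^ 2)) := by
  simp [Matrix.det_succ_row_zero, Fin.sum_univ_succ, Fin.succAbove]
  ring

open Polynomial in
theorem X_sq_dvd_charpoly_M4 (t : ℂ) : (X ^ 2 : ℂ[X][X]) ∣ (M4 t).charpoly := by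
  have key := det_eq_sq_mul_of_M4_pattern (X : ℂ[X][X]) (C (C (2 * t) * X)) (C (C (-2 * t)))
    (C (4 * X)) (C 4)
  refine Dvd.intro _ (key.symm.trans (congrArg Matrix.det ?_))
  ext1 i j
  fin_cases i <;> fin_cases j <;> simp [M4]

theorem sylvesterRes_eq_zero_of_coeff_zero {R : Type*} [CommRing R] {m n : ℕ}
    {p q : Polynomial R} (hmn : 0 < m + n) (hp : p.coeff 0 = 0) (hq : q.coeff 0 = 0) :
    sylvesterRes m n p q = 0 := by
  refine Matrix.det_eq_zero_of_column_eq_zero (⟨m + n - 1, by omega⟩ : Fin (m + n)) fun i => ?_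
  have hi := i.isLt
  simp only [Matrix.of_apply]
  split_ifs with h₁ h₂ h₂
  · rwa [show m + (i : ℕ) - (m + n - 1) = 0 by omega]
  · rfl
  · rwa [show (i : ℕ) - n + n - (m + n - 1) = 0 by omega]
  · rfl

/-- For every `t₄ ∈ ℂ`, the resultant of the characteristic polynomial of `M4 t₄`
with its derivative vanishes; in particular the characteristic polynomial of
`M4 t₄` over `ℂ(q)` is not squarefree, i.e. `M4 t₄` has non-simple spectrum. -/
theorem non_simple_spectrum_M4 (t : ℂ) :
    sylvesterRes 6 5 (M4 t).charpoly (M4 t).charpoly.derivative = 0 ∧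
      ¬ Squarefree
        ((M4 t).map (algebraMap (Polynomial ℂ) (RatFunc ℂ))).charpoly := by
  obtain ⟨h, hX⟩ := X_sq_dvd_charpoly_M4 t
  refine ⟨sylvesterRes_eq_zero_of_coeff_zero (by norm_num) ?_ ?_, fun hsq => ?_⟩
  · rw [hX, Polynomial.coeff_X_pow_mul']
    simp
  · rw [hX, Polynomial.coeff_derivative, Polynomial.coeff_X_pow_mul']
    simp
  · refine Polynomial.not_isUnit_X (hsq Polynomial.X ?_)
    rw [Matrix.charpoly_map, hX, Polynomial.map_mul, Polynomial.map_pow, Polynomial.map_X, pow_two]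
    exact dvd_mul_right _ _
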